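/- Let n be a positive integer and define a_{i,m} := (m+2−i)_i (n−m−i)_{i−1} / ((1)_{i−1}(2)_{i−1}), where (a)_j is the Pochhammer symbol. In the double polar coordinates q₁ = r cos φ, q₂ = r sin φ, p₁ = p cos ψ, p₂ = p sin ψ, the function I := pⁿ sin(nψ) + Σ_{i=1}^{⌊n/2⌋} (−2)^i ( p^{n−2i} / ( r^{2i} cos^{2i}(nφ) ) ) Σ_{m=i−1}^{n−1−i} a_{i,m} sin[ 2(n−m−1)φ − (n−2m−2)ψ ] is a first integral of the Hamiltonian H = (1/2)(p₁² + p₂²) + 1/( (q₁²+q₂²) cos²(n·atan2(q₂,q₁)) ): I is constant along every solution of the canonical Hamilton equations q̇ᵢ = ∂H/∂pᵢ, ṗᵢ = −∂H/∂qᵢ that stays in the region where r > 0, p > 0 and cos(nφ) ≠ 0. -/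

import Mathlib

open Real

/-- The coefficients `a_{i,m} = (m+2-i)_i (n-m-i)_{i-1} / ((1)_{i-1} (2)_{i-1})`
expressed with Pochhammer symbols. -/
noncomputable def ttwCoeff (n i m : ℕ) : ℝ :=
  (ascPochhammer ℝ i).eval ((m : ℝ) + 2 - (i : ℝ))
    * (ascPochhammer ℝ (i - 1)).eval ((n : ℝ) - (m : ℝ) - (i : ℝ))
    / ((ascPochhammer ℝ (i - 1)).eval 1 * (ascPochhammer ℝ (i - 1)).eval 2)

/-- The polar angle `atan2(y, x)` of the point `(x, y)`, via the complex argument. -/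
noncomputable def atan2 (y x : ℝ) : ℝ := Complex.arg (x + y * Complex.I)

/-- The first integral `I` of the TTW Hamiltonian with `a = 1`, `b = 0`, written in
double polar coordinates `q₁ = r cos φ, q₂ = r sin φ, p₁ = p cos ψ, p₂ = p sin ψ`
and regarded as a function of `(q₁, q₂, p₁, p₂)` via `r² = q₁² + q₂²`,
`p² = p₁² + p₂²`, `φ = atan2(q₂,q₁)`, `ψ = atan2(p₂,p₁)`. -/
noncomputable def ttwIntegral (n : ℕ) (q₁ q₂ p₁ p₂ : ℝ) : ℝ :=
  let r := Real.sqrt (q₁ ^ 2 + q₂ ^ 2)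
  let p := Real.sqrt (p₁ ^ 2 + p₂ ^ 2)
  let φ := atan2 q₂ q₁
  let ψ := atan2 p₂ p₁
  p ^ n * Real.sin (n * ψ)
    + ∑ i ∈ Finset.Icc 1 (n / 2),
        (-2 : ℝ) ^ i * (p ^ (n - 2 * i) / (r ^ (2 * i) * Real.cos (n * φ) ^ (2 * i)))
          * ∑ m ∈ Finset.Icc (i - 1) (n - 1 - i),
              ttwCoeff n i m
                * Real.sin (2 * ((n : ℝ) - m - 1) * φ - ((n : ℝ) - 2 * m - 2) * ψ)

section GeneratingFunction

open PowerSeries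

/-- The power series `(1 - x X)⁻ˡ`. -/
noncomputable def geomPow (x : ℂ) (l : ℕ) : PowerSeries ℂ :=
  PowerSeries.mk fun a => (Nat.multichoose l a : ℂ) * x ^ a

lemma geomPow_zero (x : ℂ) : geomPow x 0 = 1 := by
  ext (_ | a)
  · simp [geomPow]
  · simp [geomPow, coeff_one]

lemma one_sub_mul_geomPow_succ (x : ℂ) (l : ℕ) :
    (1 - C x * X) * geomPow x (l + 1) = geomPow x l := by
  ext (_ | a)
  · simp [geomPow, sub_mul, mul_assoc]
  · rw [sub_mul, one_mul, map_sub, mul_assoc, coeff_C_mul, coeff_succ_X_mul]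
    simp only [geomPow, coeff_mk, Nat.multichoose_succ_succ]
    push_cast
    ring

lemma mul_sum_geomPow (x y w : ℂ) (N : ℕ) :
    ((1 - C x * X) * (1 - C y * X) - C w * X ^ 2) *
        ∑ l ∈ Finset.range (N + 1), (C w * X ^ 2) ^ l * (geomPow x (l + 1) * geomPow y l)
      = (1 - C y * X) - (C w * X ^ 2) ^ (N + 1) * (geomPow x (N + 1) * geomPow y N) := by
  induction N with
  | zero =>
    have h := one_sub_mul_geomPow_succ x 0
    rw [geomPow_zero] at h
    simp only [zero_add, Finset.range_one, Finset.sum_singleton, pow_zero, geomPow_zero]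
    linear_combination (1 - C y * X) * h
  | succ N ih =>
    rw [Finset.sum_range_succ, mul_add, ih]
    have hx := one_sub_mul_geomPow_succ x (N + 1)
    have hy := one_sub_mul_geomPow_succ y N
    linear_combination (C w * X ^ 2) ^ (N + 1) * ((1 - C y * X) * geomPow y (N + 1) * hx
      + geomPow x (N + 1) * hy)

/-- The homogeneous part of degree `N` of `(1 - x)⁻⁽ˡ⁺¹⁾ (1 - y)⁻ˡ`. -/
noncomputable def homPart (x y : ℂ) (l N : ℕ) : ℂ :=
  ∑ ab ∈ Finset.HasAntidiagonal.antidiagonal N,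
    (Nat.multichoose (l + 1) ab.1 : ℂ) * x ^ ab.1 * ((Nat.multichoose l ab.2 : ℂ) * y ^ ab.2)

lemma coeff_geomPow_mul (x y : ℂ) (l N : ℕ) :
    coeff N (geomPow x (l + 1) * geomPow y l) = homPart x y l N := by
  simp [coeff_mul, geomPow, homPart]

/-- Closed form of the weighted sum of the homogeneous parts in terms of the roots of
`t² - (x + y) t + (x y - w)`. -/
lemma sub_mul_sum_homPart {x y w α β : ℂ} (hadd : α + β = x + y) (hmul : α * β = x * y - w)
    (n : ℕ) :
    (α - β) * ∑ l ∈ Finset.range (n / 2 + 1), w ^ l * homPart x y l (n - 2 * l)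
      = (α - y) * α ^ n - (β - y) * β ^ n := by
  set N := n / 2 with hN
  have key := mul_sum_geomPow x y w N
  set T := ∑ l ∈ Finset.range (N + 1), (C w * X ^ 2) ^ l * (geomPow x (l + 1) * geomPow y l)
    with hT
  have hα := one_sub_mul_geomPow_succ α 0
  have hβ := one_sub_mul_geomPow_succ β 0
  rw [geomPow_zero, zero_add] at hα hβ
  have hadd' : (C α + C β : PowerSeries ℂ) = C x + C y := by rw [← map_add, hadd, map_add]
  have hmul' : (C α * C β : PowerSeries ℂ) = C x * C y - C w := by
    rw [← map_mul, hmul, map_sub, map_mul]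
  have hfac : ((1 - C x * X) * (1 - C y * X) - C w * X ^ 2 : PowerSeries ℂ)
      = (1 - C α * X) * (1 - C β * X) := by
    linear_combination X * hadd' - X ^ 2 * hmul'
  rw [hfac] at key
  have hdiff : C (α - β) * T = (C (α - y) * geomPow α 1 - C (β - y) * geomPow β 1)
      - X ^ (2 * N + 2) * (C (α - β) * C w ^ (N + 1) * geomPow α 1 * geomPow β 1 *
        (geomPow x (N + 1) * geomPow y N)) := by
    have e : (X ^ (2 * N + 2) : PowerSeries ℂ) = (X ^ 2) ^ (N + 1) := by rw [← pow_mul]; ring_nf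
    rw [mul_pow] at key
    rw [e]
    simp only [map_sub]
    generalize geomPow α 1 = a at *
    generalize geomPow β 1 = b at *
    generalize (X ^ 2 : PowerSeries ℂ) ^ (N + 1) = ξ at *
    generalize C w ^ (N + 1) = ω at *
    generalize geomPow x (N + 1) * geomPow y N = d at *
    linear_combination (C α - C β) * a * b * key
      - (C α - C β) * T * (hα * (1 - C β * X) * b + hβ)
      + ((C α - C y) * a * hβ - (C β - C y) * b * hα)
  have hc := congrArg (coeff n) hdiff
  rw [coeff_C_mul, map_sub (coeff (R := ℂ) n), coeff_X_pow_mul', if_neg (by omega), sub_zero] at hc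
  have hTn : coeff n T = ∑ l ∈ Finset.range (N + 1), w ^ l * homPart x y l (n - 2 * l) := by
    rw [hT, map_sum]
    refine Finset.sum_congr rfl fun l hl => ?_
    rw [Finset.mem_range] at hl
    rw [mul_pow, ← map_pow, mul_assoc, coeff_C_mul, ← pow_mul, coeff_X_pow_mul',
      if_pos (by omega), coeff_geomPow_mul]
  rw [← hTn, hc, map_sub, coeff_C_mul, coeff_C_mul]
  simp [geomPow]

end GeneratingFunction

lemma ttwCoeff_eq_multichoose (j a b : ℕ) :
    ttwCoeff (2 * (j + 1) + (a + b)) (j + 1) (j + a)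
      = Nat.multichoose (j + 2) a * Nat.multichoose (j + 1) b := by
  have hP : ∀ c k : ℕ, (ascPochhammer ℝ k).eval ((c + 1 : ℕ) : ℝ)
      = (k.factorial : ℝ) * ((c + k).choose k : ℝ) := by
    intro c k
    rw [← ascPochhammer_eval_cast, ascPochhammer_nat_eq_ascFactorial,
      Nat.ascFactorial_eq_factorial_mul_choose]
    push_cast; ring
  have h1 := hP a (j + 1)
  have h2 := hP b j
  have h3 := hP 0 j
  have h4 := hP 1 j
  have e1 : (((j + a : ℕ) : ℝ) + 2 - ((j + 1 : ℕ) : ℝ)) = ((a + 1 : ℕ) : ℝ) := by push_cast; ring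
  have e2 : (((2 * (j + 1) + (a + b) : ℕ) : ℝ) - ((j + a : ℕ) : ℝ) - ((j + 1 : ℕ) : ℝ))
      = ((b + 1 : ℕ) : ℝ) := by push_cast; ring
  have c1 : (a + (j + 1)).choose (j + 1) = Nat.multichoose (j + 2) a := by
    rw [Nat.multichoose_eq, show j + 2 + a - 1 = a + (j + 1) by omega, Nat.choose_symm_add]
  have c2 : (b + j).choose j = Nat.multichoose (j + 1) b := by
    rw [Nat.multichoose_eq, show j + 1 + b - 1 = b + j by omega, Nat.choose_symm_add]
  have c4 : (1 + j).choose j = j + 1 := by rw [add_comm, Nat.choose_succ_self_right]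
  rw [c1] at h1
  rw [c2] at h2
  rw [c4] at h4
  rw [zero_add, zero_add, Nat.choose_self, Nat.cast_one, mul_one] at h3
  rw [show ((1 + 1 : ℕ) : ℝ) = 2 by norm_num] at h4
  rw [ttwCoeff, e1, e2, Nat.add_sub_cancel, h1, h2, h3, h4, Nat.factorial_succ]
  have := Nat.factorial_pos j
  push_cast
  field_simp

lemma pow_mul_sin_eq_im (p θ δ : ℝ) (a b : ℕ) :
    p ^ (a + b) * sin (θ + ((a : ℝ) - b) * δ)
      = (Complex.exp (θ * Complex.I) * ((p * Complex.exp (δ * Complex.I)) ^ a *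
          (p * Complex.exp (-(δ * Complex.I))) ^ b)).im := by
  have h : Complex.exp (θ * Complex.I) * ((p * Complex.exp (δ * Complex.I)) ^ a *
          (p * Complex.exp (-(δ * Complex.I))) ^ b)
      = ((p ^ (a + b) : ℝ) : ℂ) *
        Complex.exp (((θ + ((a : ℝ) - b) * δ : ℝ) : ℂ) * Complex.I) := by
    have e : (((θ + ((a : ℝ) - b) * δ : ℝ) : ℂ) * Complex.I)
        = θ * Complex.I + (a * (δ * Complex.I) + b * (-(δ * Complex.I))) := by
      push_cast; ring
    rw [e, Complex.exp_add, Complex.exp_add, Complex.exp_nat_mul, Complex.exp_nat_mul]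
    push_cast
    ring
  rw [h, Complex.im_ofReal_mul, Complex.exp_ofReal_mul_I_im]

lemma ttw_inner_sum_eq (j N : ℕ) (p φ ψ : ℝ) :
    p ^ N * ∑ m ∈ Finset.Icc j (j + N), ttwCoeff (2 * (j + 1) + N) (j + 1) m *
        sin (2 * (((2 * (j + 1) + N : ℕ) : ℝ) - m - 1) * φ
          - (((2 * (j + 1) + N : ℕ) : ℝ) - 2 * m - 2) * ψ)
      = (Complex.exp (((((2 * (j + 1) + N : ℕ) : ℝ) * φ : ℝ) : ℂ) * Complex.I) *
          homPart (p * Complex.exp ((ψ - φ : ℝ) * Complex.I))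
            (p * Complex.exp (-((ψ - φ : ℝ) * Complex.I))) (j + 1) N).im := by
  have hI : Finset.Icc j (j + N) = Finset.Ico (0 + j) (N + 1 + j) := by
    ext; simp only [Finset.mem_Icc, Finset.mem_Ico]; omega
  rw [hI, ← Finset.sum_Ico_add', ← Finset.range_eq_Ico, homPart,
    Finset.Nat.sum_antidiagonal_eq_sum_range_succ_mk, Finset.mul_sum, Finset.mul_sum,
    Complex.im_sum]
  refine Finset.sum_congr rfl fun a ha => ?_
  obtain ⟨b, rfl⟩ : ∃ b, N = a + b := ⟨N - a, by rw [Finset.mem_range] at ha; omega⟩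
  have hb : a + b - a = b := by omega
  simp only [hb]
  rw [add_comm a j, ttwCoeff_eq_multichoose]
  have hs := pow_mul_sin_eq_im p (((2 * (j + 1) + (a + b) : ℕ) : ℝ) * φ) (ψ - φ) a b
  have e1 : 2 * (((2 * (j + 1) + (a + b) : ℕ) : ℝ) - ((j + a : ℕ) : ℝ) - 1) * φ
          - (((2 * (j + 1) + (a + b) : ℕ) : ℝ) - 2 * ((j + a : ℕ) : ℝ) - 2) * ψ
      = ((2 * (j + 1) + (a + b) : ℕ) : ℝ) * φ + ((a : ℝ) - b) * (ψ - φ) := by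
    push_cast; ring
  rw [e1]
  generalize Complex.exp (((((2 * (j + 1) + (a + b) : ℕ) : ℝ) * φ : ℝ) : ℂ) * Complex.I) = E at *
  generalize (p * Complex.exp ((ψ - φ : ℝ) * Complex.I)) = x at *
  generalize (p * Complex.exp (-((ψ - φ : ℝ) * Complex.I))) = y at *
  have e2 : E * (((j + 1 + 1).multichoose a : ℂ) * x ^ a * (((j + 1).multichoose b : ℂ) * y ^ b))
      = (((((j + 1 + 1).multichoose a : ℝ) * ((j + 1).multichoose b : ℝ) : ℝ)) : ℂ)
        * (E * (x ^ a * y ^ b)) := by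
    push_cast; ring
  rw [e2, Complex.im_ofReal_mul, ← hs]
  ring

lemma ttwIntegral_eq_im (n : ℕ) (q₁ q₂ p₁ p₂ : ℝ) (r p φ ψ : ℝ)
    (hr : r = √(q₁ ^ 2 + q₂ ^ 2)) (hp : p = √(p₁ ^ 2 + p₂ ^ 2))
    (hφ : φ = atan2 q₂ q₁) (hψ : ψ = atan2 p₂ p₁) :
    ttwIntegral n q₁ q₂ p₁ p₂
      = (Complex.exp (((n * φ : ℝ) : ℂ) * Complex.I) *
          ∑ l ∈ Finset.range (n / 2 + 1), ((-2 / (r ^ 2 * cos (n * φ) ^ 2) : ℝ) : ℂ) ^ l *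
            homPart (p * Complex.exp ((ψ - φ : ℝ) * Complex.I))
              (p * Complex.exp (-((ψ - φ : ℝ) * Complex.I))) l (n - 2 * l)).im := by
  have hI : Finset.Icc 1 (n / 2) = Finset.Ico (0 + 1) (n / 2 + 1) := by
    ext; simp only [Finset.mem_Icc, Finset.mem_Ico]; omega
  simp only [ttwIntegral]
  rw [← hr, ← hp, ← hφ, ← hψ, hI, ← Finset.sum_Ico_add', ← Finset.range_eq_Ico,
    Finset.sum_range_succ', mul_add, Complex.add_im, add_comm]
  congr 1
  · rw [Finset.mul_sum, Complex.im_sum]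
    refine Finset.sum_congr rfl fun j hj => ?_
    rw [Finset.mem_range] at hj
    obtain ⟨N, rfl⟩ : ∃ N, n = 2 * (j + 1) + N := ⟨n - 2 * (j + 1), by omega⟩
    rw [show 2 * (j + 1) + N - 1 - (j + 1) = j + N by omega, Nat.add_sub_cancel,
      Nat.add_sub_cancel_left]
    have hs := ttw_inner_sum_eq j N p φ ψ
    rw [mul_left_comm, ← Complex.ofReal_pow, Complex.im_ofReal_mul, ← hs, div_pow, mul_pow,
      ← pow_mul, ← pow_mul]
    ring
  · have h0 := pow_mul_sin_eq_im p (n * φ) (ψ - φ) n 0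
    have e : (n : ℝ) * φ + ((n : ℝ) - (0 : ℕ)) * (ψ - φ) = n * ψ := by push_cast; ring
    rw [e, add_zero] at h0
    rw [h0, homPart, Finset.sum_eq_single (n, 0)]
    · simp [Nat.multichoose_one]
    · rintro ⟨a, b⟩ hab hne
      rw [Finset.HasAntidiagonal.mem_antidiagonal] at hab
      cases b with
      | zero => exact absurd (by simpa using hab) (by simpa using hne)
      | succ b => simp
    · intro h; simp at h

lemma norm_mul_exp_atan2 (x y : ℝ) :
    (√(x ^ 2 + y ^ 2) : ℂ) * Complex.exp (atan2 y x * Complex.I) = x + y * Complex.I := by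
  have h := Complex.norm_mul_exp_arg_mul_I ((x : ℂ) + y * Complex.I)
  rwa [Complex.norm_add_mul_I] at h

lemma pow_mul_exp_mul_atan2 (n : ℕ) (x y : ℝ) :
    (√(x ^ 2 + y ^ 2) : ℂ) ^ n * Complex.exp (((n * atan2 y x : ℝ) : ℂ) * Complex.I)
      = (x + y * Complex.I) ^ n := by
  rw [← norm_mul_exp_atan2, mul_pow, ← Complex.exp_nat_mul]
  push_cast
  ring_nf

lemma pow_mul_cos_mul_atan2 (n : ℕ) (x y : ℝ) :
    √(x ^ 2 + y ^ 2) ^ n * cos (n * atan2 y x) = (((x : ℂ) + y * Complex.I) ^ n).re := by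
  rw [← pow_mul_exp_mul_atan2, ← Complex.ofReal_pow, Complex.re_ofReal_mul,
    Complex.exp_ofReal_mul_I_re]

lemma pow_mul_cos_mul_atan2_sq (n : ℕ) (x y : ℝ) :
    (x ^ 2 + y ^ 2) ^ n * cos (n * atan2 y x) ^ 2
      = (((x : ℂ) + y * Complex.I) ^ n).re ^ 2 := by
  rw [← pow_mul_cos_mul_atan2, mul_pow, ← pow_mul, mul_comm n 2, pow_mul,
    Real.sq_sqrt (by positivity)]

lemma ttw_potential_eq (k : ℕ) {x y : ℝ} (h : 0 < x ^ 2 + y ^ 2) :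
    1 / ((x ^ 2 + y ^ 2) * cos ((k + 1 : ℕ) * atan2 y x) ^ 2)
      = (x ^ 2 + y ^ 2) ^ k / (((x : ℂ) + y * Complex.I) ^ (k + 1)).re ^ 2 := by
  rw [← pow_mul_cos_mul_atan2_sq]
  generalize x ^ 2 + y ^ 2 = R at *
  rw [pow_succ R, mul_assoc, ← mul_div_mul_left _ _ (pow_pos h k).ne', mul_one]

/-- Closed form of the integral: up to normalization it is the real part of the product of a
power of `q ⬝ p - i M` and `M Im zⁿ + i L Re zⁿ`, where `L` is the angular momentum and
`M² = 2 (L² / 2 + r² V)`. -/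
lemma ttwIntegral_eq_re (n : ℕ) {q₁ q₂ p₁ p₂ M : ℝ} (hR : 0 < q₁ ^ 2 + q₂ ^ 2)
    (hC : (((q₁ : ℂ) + q₂ * Complex.I) ^ n).re ≠ 0) (hM : 0 < M)
    (hM2 : M ^ 2 = (q₁ * p₂ - q₂ * p₁) ^ 2
      + 2 * ((q₁ ^ 2 + q₂ ^ 2) ^ n / (((q₁ : ℂ) + q₂ * Complex.I) ^ n).re ^ 2)) :
    ttwIntegral n q₁ q₂ p₁ p₂
      = ((((q₁ * p₁ + q₂ * p₂ : ℝ) : ℂ) - M * Complex.I) ^ n *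
          (((M * (((q₁ : ℂ) + q₂ * Complex.I) ^ n).im : ℝ) : ℂ)
            + (((q₁ * p₂ - q₂ * p₁) * (((q₁ : ℂ) + q₂ * Complex.I) ^ n).re : ℝ) : ℂ)
              * Complex.I)).re / (M * (q₁ ^ 2 + q₂ ^ 2) ^ n) := by
  set r := √(q₁ ^ 2 + q₂ ^ 2) with hr
  set p := √(p₁ ^ 2 + p₂ ^ 2) with hp
  set φ := atan2 q₂ q₁ with hφ
  set ψ := atan2 p₂ p₁ with hψ
  have hr0 : 0 < r := Real.sqrt_pos.2 hR
  have hr2 : q₁ ^ 2 + q₂ ^ 2 = r ^ 2 := (Real.sq_sqrt hR.le).symm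
  have hz := norm_mul_exp_atan2 q₁ q₂
  have hw := norm_mul_exp_atan2 p₁ p₂
  have hu := pow_mul_exp_mul_atan2 n q₁ q₂
  have hc := pow_mul_cos_mul_atan2_sq n q₁ q₂
  rw [← hr, ← hφ] at hz hu
  rw [← hφ] at hc
  rw [← hp, ← hψ] at hw
  rw [ttwIntegral_eq_im n q₁ q₂ p₁ p₂ r p φ ψ hr hp hφ hψ]
  set x := (p : ℂ) * Complex.exp ((ψ - φ : ℝ) * Complex.I) with hx
  set y := (p : ℂ) * Complex.exp (-((ψ - φ : ℝ) * Complex.I)) with hy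
  set Z := ((q₁ : ℂ) + q₂ * Complex.I) ^ n
  set E := Complex.exp (((n * φ : ℝ) : ℂ) * Complex.I)
  set ρ := q₁ * p₁ + q₂ * p₂ with hρ
  set L := q₁ * p₂ - q₂ * p₁ with hL
  have hrC : (r : ℂ) ≠ 0 := by exact_mod_cast hr0.ne'
  have hzc : (r : ℂ) * Complex.exp (-(φ * Complex.I)) = q₁ - q₂ * Complex.I := by
    have := congrArg (starRingEnd ℂ) hz
    simpa [← Complex.exp_conj, sub_eq_add_neg] using this
  have hwc : (p : ℂ) * Complex.exp (-(ψ * Complex.I)) = p₁ - p₂ * Complex.I := by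
    have := congrArg (starRingEnd ℂ) hw
    simpa [← Complex.exp_conj, sub_eq_add_neg] using this
  have hxr : x = (ρ + L * Complex.I) / r := by
    rw [eq_div_iff hrC, hx]
    have : Complex.exp ((ψ - φ : ℝ) * Complex.I)
        = Complex.exp (ψ * Complex.I) * Complex.exp (-(φ * Complex.I)) := by
      rw [← Complex.exp_add]; push_cast; ring_nf
    rw [this]
    calc _ = (p * Complex.exp (ψ * Complex.I)) * (r * Complex.exp (-(φ * Complex.I))) := by ring
      _ = _ := by
        rw [hw, hzc, hρ, hL]; push_cast
        linear_combination (-(p₂ : ℂ) * q₂) * Complex.I_sq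
  have hyr : y = (ρ - L * Complex.I) / r := by
    rw [eq_div_iff hrC, hy]
    have : Complex.exp (-((ψ - φ : ℝ) * Complex.I))
        = Complex.exp (-(ψ * Complex.I)) * Complex.exp (φ * Complex.I) := by
      rw [← Complex.exp_add]; push_cast; ring_nf
    rw [this]
    calc _ = (p * Complex.exp (-(ψ * Complex.I))) * (r * Complex.exp (φ * Complex.I)) := by ring
      _ = _ := by
        rw [hwc, hz, hρ, hL]; push_cast
        linear_combination (-(p₂ : ℂ) * q₂) * Complex.I_sq
  have hcos : cos (n * φ) ≠ 0 := by
    intro h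
    rw [h] at hc
    exact hC (by simpa using hc.symm)
  have hV : (q₁ ^ 2 + q₂ ^ 2) ^ n / Z.re ^ 2 = 1 / cos (n * φ) ^ 2 := by
    rw [← hc]
    have := (pow_pos hR n).ne'
    field_simp
  rw [hV] at hM2
  have hadd : (ρ - M * Complex.I) / r + (ρ + M * Complex.I) / r = x + y := by
    rw [hxr, hyr]; ring
  have hmul : (ρ - M * Complex.I) / r * ((ρ + M * Complex.I) / r)
      = x * y - ((-2 / (r ^ 2 * cos (n * φ) ^ 2) : ℝ) : ℂ) := by
    have hM2C : (M : ℂ) ^ 2 = L ^ 2 + 2 * (1 / (cos (n * φ) : ℝ) ^ 2) := by exact_mod_cast hM2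
    have hcC : ((cos (n * φ) : ℝ) : ℂ) ≠ 0 := by exact_mod_cast hcos
    rw [hxr, hyr]
    push_cast only [Complex.ofReal_div, Complex.ofReal_mul, Complex.ofReal_pow, Complex.ofReal_neg]
    generalize ((cos (n * φ) : ℝ) : ℂ) = c at *
    have h1 : (c : ℂ) ^ 2 * M ^ 2 = c ^ 2 * L ^ 2 + 2 := by
      rw [hM2C]; field_simp
    field_simp
    push_cast
    linear_combination h1 - (c ^ 2 * (M ^ 2 - L ^ 2)) * Complex.I_sq
  have hG := sub_mul_sum_homPart hadd hmul n
  set G := ∑ l ∈ Finset.range (n / 2 + 1), ((-2 / (r ^ 2 * cos (n * φ) ^ 2) : ℝ) : ℂ) ^ l *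
            homPart x y l (n - 2 * l)
  set Λ := (ρ : ℂ) - M * Complex.I with hΛ
  have hconj : (ρ : ℂ) + M * Complex.I = starRingEnd ℂ Λ := by simp [hΛ]
  have hG2 : 2 * M * (r : ℂ) ^ n * G = (M - L) * Λ ^ n + (M + L) * starRingEnd ℂ (Λ ^ n) := by
    rw [map_pow, ← hconj]
    have hrn := pow_ne_zero n hrC
    rw [hyr, div_pow, div_pow] at hG
    rw [hΛ] at hG ⊢
    generalize ((ρ : ℂ) - M * Complex.I) ^ n = a at *
    generalize ((ρ : ℂ) + M * Complex.I) ^ n = b at *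
    field_simp at hG
    linear_combination Complex.I * hG
      + (2 * M * (r : ℂ) ^ n * G - (M - L) * a - (M + L) * b) * Complex.I_sq
  have hfin : ((2 * M * r ^ (2 * n) : ℝ) : ℂ) * (E * G)
      = Z * ((M - L) * Λ ^ n + (M + L) * starRingEnd ℂ (Λ ^ n)) := by
    rw [← hG2, ← hu]; push_cast; ring
  have him := congrArg Complex.im hfin
  rw [Complex.im_ofReal_mul] at him
  rw [hr2, ← pow_mul, eq_div_iff (by positivity)]
  simp only [Complex.mul_im, Complex.mul_re, Complex.add_im, Complex.add_re, Complex.sub_re,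
    Complex.sub_im, Complex.ofReal_re, Complex.ofReal_im, Complex.conj_re, Complex.conj_im,
    Complex.I_re, Complex.I_im] at him ⊢
  linear_combination him / 2

/-- The flow of the Hamiltonian in terms of `R = q₁² + q₂²`, `ρ = q ⬝ p`, the angular momentum
`L` and `C + i S = (q₁ + i q₂)ⁿ`, `n = k + 1`, preserves the closed form of the integral. -/
lemma hasDerivAt_closed_form_zero (k : ℕ) {R ρ L C S : ℝ → ℝ} {P t : ℝ} (hR0 : 0 < R t)
    (hC0 : C t ≠ 0) (hP : R t * P = ρ t ^ 2 + L t ^ 2)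
    (hR : HasDerivAt R (2 * ρ t) t)
    (hρ : HasDerivAt ρ (P + 2 * (R t ^ k / C t ^ 2)) t)
    (hL : HasDerivAt L (-(2 * (k + 1) * R t ^ k * S t / C t ^ 3)) t)
    (hC : HasDerivAt C ((k + 1) * (C t * ρ t - S t * L t) / R t) t)
    (hS : HasDerivAt S ((k + 1) * (S t * ρ t + C t * L t) / R t) t) :
    HasDerivAt (fun s =>
      ((((ρ s : ℝ) : ℂ) - (√(L s ^ 2 + 2 * (R s ^ (k + 1) / C s ^ 2)) : ℝ) * Complex.I) ^ (k + 1) *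
          (((√(L s ^ 2 + 2 * (R s ^ (k + 1) / C s ^ 2)) * S s : ℝ) : ℂ)
            + ((L s * C s : ℝ) : ℂ) * Complex.I)).re
        / (√(L s ^ 2 + 2 * (R s ^ (k + 1) / C s ^ 2)) * R s ^ (k + 1))) 0 t := by
  set M : ℝ → ℝ := fun s => √(L s ^ 2 + 2 * (R s ^ (k + 1) / C s ^ 2))
  have hpos : 0 < L t ^ 2 + 2 * (R t ^ (k + 1) / C t ^ 2) := by positivity
  have hM0 : 0 < M t := Real.sqrt_pos.2 hpos
  have hMsq : M t ^ 2 = L t ^ 2 + 2 * (R t ^ (k + 1) / C t ^ 2) := Real.sq_sqrt hpos.le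
  have hM : HasDerivAt M 0 t := by
    have h := ((hL.fun_pow 2).fun_add (((hR.fun_pow (k + 1)).fun_div (hC.fun_pow 2)
      (pow_ne_zero 2 hC0)).const_mul 2)).sqrt hpos.ne'
    refine h.congr_deriv ?_
    rw [div_eq_zero_iff]
    left
    simp only [Nat.add_sub_cancel]
    push_cast
    field_simp
    ring
  have hP' : P + 2 * (R t ^ k / C t ^ 2) = (ρ t ^ 2 + M t ^ 2) / R t := by
    rw [hMsq, eq_div_iff hR0.ne']
    linear_combination hP
  have hΛ : HasDerivAt (fun s => ((ρ s : ℝ) : ℂ) - (M s : ℝ) * Complex.I)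
      (((ρ t : ℂ) - M t * Complex.I) * ((ρ t : ℂ) + M t * Complex.I) / R t) t := by
    refine (hρ.ofReal_comp.fun_sub (hM.ofReal_comp.mul_const Complex.I)).congr_deriv ?_
    rw [hP']
    push_cast
    linear_combination ((M t : ℂ) ^ 2 / R t) * Complex.I_sq
  have hB : HasDerivAt (fun s => ((M s * S s : ℝ) : ℂ) + ((L s * C s : ℝ) : ℂ) * Complex.I)
      (((k + 1 : ℝ) / R t : ℝ) * (((ρ t : ℂ) - M t * Complex.I) *
        (((M t * S t : ℝ) : ℂ) + ((L t * C t : ℝ) : ℂ) * Complex.I))) t := by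
    refine (((hM.fun_mul hS).ofReal_comp).fun_add
      (((hL.fun_mul hC).ofReal_comp).mul_const Complex.I)).congr_deriv ?_
    apply Complex.ext
    · simp only [Complex.mul_im, Complex.mul_re, Complex.add_im, Complex.add_re, Complex.sub_re,
        Complex.sub_im, Complex.ofReal_re, Complex.ofReal_im, Complex.I_re, Complex.I_im]
      ring
    · simp only [Complex.mul_im, Complex.mul_re, Complex.add_im, Complex.add_re, Complex.sub_re,
        Complex.sub_im, Complex.ofReal_re, Complex.ofReal_im, Complex.I_re, Complex.I_im]
      have hI : -(2 * (k + 1) * R t ^ k * S t / C t ^ 3) * C t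
            + L t * ((k + 1) * (C t * ρ t - S t * L t) / R t)
          = (k + 1) / R t * (ρ t * (L t * C t) - M t ^ 2 * S t) := by
        rw [hMsq]
        field_simp
        ring
      linear_combination hI
  have hW : HasDerivAt (fun s => (((ρ s : ℝ) : ℂ) - (M s : ℝ) * Complex.I) ^ (k + 1) *
        (((M s * S s : ℝ) : ℂ) + ((L s * C s : ℝ) : ℂ) * Complex.I))
      ((((k + 1) * (2 * ρ t) / R t : ℝ) : ℂ) * ((((ρ t : ℝ) : ℂ) - (M t : ℝ) * Complex.I) ^ (k + 1)
        * (((M t * S t : ℝ) : ℂ) + ((L t * C t : ℝ) : ℂ) * Complex.I))) t := by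
    refine ((hΛ.fun_pow (k + 1)).fun_mul hB).congr_deriv ?_
    simp only [Nat.add_sub_cancel]
    push_cast
    ring
  have hWre := Complex.reCLM.hasFDerivAt.comp_hasDerivAt t hW
  refine (hWre.fun_div (hM.fun_mul (hR.fun_pow (k + 1)))
    (mul_ne_zero hM0.ne' (pow_ne_zero _ hR0.ne'))).congr_deriv ?_
  rw [div_eq_zero_iff]
  left
  simp only [Function.comp_apply, Complex.reCLM_apply, Complex.re_ofReal_mul, Nat.add_sub_cancel]
  generalize (((ρ t : ℂ) - M t * Complex.I) ^ (k + 1)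
        * (((M t * S t : ℝ) : ℂ) + ((L t * C t : ℝ) : ℂ) * Complex.I)).re = w
  push_cast
  have := hR0.ne'
  field_simp
  ring

lemma hasDerivAt_re_pow_fst (n : ℕ) (x y : ℝ) :
    HasDerivAt (fun x : ℝ => (((x : ℂ) + y * Complex.I) ^ n).re)
      (n * (((x : ℂ) + y * Complex.I) ^ (n - 1)).re) x := by
  have h := (((hasDerivAt_id (x : ℂ)).add_const (y * Complex.I)).fun_pow n).real_of_complex
  refine h.congr_deriv ?_
  simp [← Complex.ofReal_natCast]

lemma hasDerivAt_re_pow_snd (n : ℕ) (x y : ℝ) :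
    HasDerivAt (fun y : ℝ => (((x : ℂ) + y * Complex.I) ^ n).re)
      (-(n * (((x : ℂ) + y * Complex.I) ^ (n - 1)).im)) y := by
  have h := ((((hasDerivAt_id (y : ℂ)).mul_const Complex.I).const_add (x : ℂ)).fun_pow
    n).real_of_complex
  refine h.congr_deriv ?_
  simp [← Complex.ofReal_natCast]

lemma hasDerivAt_ttw_hamiltonian_fst (k : ℕ) {x y : ℝ} (e : ℝ) (h : 0 < x ^ 2 + y ^ 2)
    (hC : (((x : ℂ) + y * Complex.I) ^ (k + 1)).re ≠ 0) :
    HasDerivAt (fun x => e + 1 / ((x ^ 2 + y ^ 2) * cos ((k + 1 : ℕ) * atan2 y x) ^ 2))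
      (2 * k * x * (x ^ 2 + y ^ 2) ^ k
          / ((x ^ 2 + y ^ 2) * (((x : ℂ) + y * Complex.I) ^ (k + 1)).re ^ 2)
        - 2 * (k + 1) * (x ^ 2 + y ^ 2) ^ k * (((x : ℂ) + y * Complex.I) ^ k).re
          / (((x : ℂ) + y * Complex.I) ^ (k + 1)).re ^ 3) x := by
  have hR : HasDerivAt (fun x : ℝ => x ^ 2 + y ^ 2) (2 * x) x := by
    simpa using (hasDerivAt_pow 2 x).add_const (y ^ 2)
  have hV := ((hR.fun_pow k).fun_div ((hasDerivAt_re_pow_fst (k + 1) x y).fun_pow 2)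
    (pow_ne_zero 2 hC)).const_add e
  have hev : ∀ᶠ u in nhds x, 0 < u ^ 2 + y ^ 2 :=
    hR.continuousAt.eventually (lt_mem_nhds h)
  refine (hV.congr_of_eventuallyEq ?_).congr_deriv ?_
  · filter_upwards [hev] with u hu
    rw [ttw_potential_eq k hu]
  · rw [Nat.add_sub_cancel]
    have := h.ne'
    cases k with
    | zero => simp; field_simp
    | succ k =>
      rw [Nat.add_sub_cancel]
      push_cast
      field_simp
      ring

lemma hasDerivAt_ttw_hamiltonian_snd (k : ℕ) {x y : ℝ} (e : ℝ) (h : 0 < x ^ 2 + y ^ 2)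
    (hC : (((x : ℂ) + y * Complex.I) ^ (k + 1)).re ≠ 0) :
    HasDerivAt (fun y => e + 1 / ((x ^ 2 + y ^ 2) * cos ((k + 1 : ℕ) * atan2 y x) ^ 2))
      (2 * k * y * (x ^ 2 + y ^ 2) ^ k
          / ((x ^ 2 + y ^ 2) * (((x : ℂ) + y * Complex.I) ^ (k + 1)).re ^ 2)
        + 2 * (k + 1) * (x ^ 2 + y ^ 2) ^ k * (((x : ℂ) + y * Complex.I) ^ k).im
          / (((x : ℂ) + y * Complex.I) ^ (k + 1)).re ^ 3) y := by
  have hR : HasDerivAt (fun y : ℝ => x ^ 2 + y ^ 2) (2 * y) y := by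
    simpa using (hasDerivAt_pow 2 y).const_add (x ^ 2)
  have hV := ((hR.fun_pow k).fun_div ((hasDerivAt_re_pow_snd (k + 1) x y).fun_pow 2)
    (pow_ne_zero 2 hC)).const_add e
  have hev : ∀ᶠ u in nhds y, 0 < x ^ 2 + u ^ 2 :=
    hR.continuousAt.eventually (lt_mem_nhds h)
  refine (hV.congr_of_eventuallyEq ?_).congr_deriv ?_
  · filter_upwards [hev] with u hu
    rw [ttw_potential_eq k hu]
  · rw [Nat.add_sub_cancel]
    have := h.ne'
    cases k with
    | zero => simp
    | succ k =>
      rw [Nat.add_sub_cancel]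
      push_cast
      field_simp
      ring

/-- The function `I` built from the Pochhammer coefficients
`a_{i,m}` is a first integral of the TTW Hamiltonian
`H = (1/2)(p₁² + p₂²) + 1/((q₁² + q₂²) cos²(n·atan2(q₂,q₁)))`:
it is constant along every solution of the canonical Hamilton equations staying in
the region `r > 0`, `p > 0`, `cos(nφ) ≠ 0`. -/
theorem ttw_polynomial_integral (n : ℕ) (hn : 0 < n)
    (H : ℝ → ℝ → ℝ → ℝ → ℝ)
    (hH : H = fun q₁ q₂ p₁ p₂ =>
      (1 / 2) * (p₁ ^ 2 + p₂ ^ 2)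
        + 1 / ((q₁ ^ 2 + q₂ ^ 2) * Real.cos (n * atan2 q₂ q₁) ^ 2))
    (α β : ℝ) (q₁ q₂ p₁ p₂ : ℝ → ℝ)
    (hreg : ∀ t ∈ Set.Ioo α β,
      0 < (q₁ t) ^ 2 + (q₂ t) ^ 2 ∧ 0 < (p₁ t) ^ 2 + (p₂ t) ^ 2 ∧
      Real.cos (n * atan2 (q₂ t) (q₁ t)) ≠ 0)
    (hq₁ : ∀ t ∈ Set.Ioo α β,
      HasDerivAt q₁ (deriv (fun x => H (q₁ t) (q₂ t) x (p₂ t)) (p₁ t)) t)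
    (hq₂ : ∀ t ∈ Set.Ioo α β,
      HasDerivAt q₂ (deriv (fun x => H (q₁ t) (q₂ t) (p₁ t) x) (p₂ t)) t)
    (hp₁ : ∀ t ∈ Set.Ioo α β,
      HasDerivAt p₁ (-deriv (fun x => H x (q₂ t) (p₁ t) (p₂ t)) (q₁ t)) t)
    (hp₂ : ∀ t ∈ Set.Ioo α β,
      HasDerivAt p₂ (-deriv (fun x => H (q₁ t) x (p₁ t) (p₂ t)) (q₂ t)) t) :
    ∀ t ∈ Set.Ioo α β, ∀ s ∈ Set.Ioo α β,
      ttwIntegral n (q₁ t) (q₂ t) (p₁ t) (p₂ t)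
        = ttwIntegral n (q₁ s) (q₂ s) (p₁ s) (p₂ s) := by
  obtain ⟨k, rfl⟩ : ∃ k, n = k + 1 := ⟨n - 1, by omega⟩
  set C : ℝ → ℝ := fun t => (((q₁ t : ℂ) + q₂ t * Complex.I) ^ (k + 1)).re with hCdef
  set S : ℝ → ℝ := fun t => (((q₁ t : ℂ) + q₂ t * Complex.I) ^ (k + 1)).im with hSdef
  set R : ℝ → ℝ := fun t => q₁ t ^ 2 + q₂ t ^ 2 with hRdef
  set ρ : ℝ → ℝ := fun t => q₁ t * p₁ t + q₂ t * p₂ t with hρdef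
  set L : ℝ → ℝ := fun t => q₁ t * p₂ t - q₂ t * p₁ t with hLdef
  have hC0 : ∀ t ∈ Set.Ioo α β, C t ≠ 0 := fun t ht h => by
    have hc := pow_mul_cos_mul_atan2_sq (k + 1) (q₁ t) (q₂ t)
    rw [show (((q₁ t : ℂ) + q₂ t * Complex.I) ^ (k + 1)).re = 0 from h] at hc
    have h1 := mul_pos (pow_pos (hreg t ht).1 (k + 1))
      (pow_pos (abs_pos.2 (hreg t ht).2.2) 2)
    rw [sq_abs, hc] at h1
    simp at h1
  have hderiv : ∀ t ∈ Set.Ioo α β, HasDerivAt (fun s =>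
      ((((ρ s : ℝ) : ℂ) - (√(L s ^ 2 + 2 * (R s ^ (k + 1) / C s ^ 2)) : ℝ) * Complex.I) ^ (k + 1) *
          (((√(L s ^ 2 + 2 * (R s ^ (k + 1) / C s ^ 2)) * S s : ℝ) : ℂ)
            + ((L s * C s : ℝ) : ℂ) * Complex.I)).re
        / (√(L s ^ 2 + 2 * (R s ^ (k + 1) / C s ^ 2)) * R s ^ (k + 1))) 0 t := by
    intro t ht
    have hR0 : 0 < R t := (hreg t ht).1
    have hCt := hC0 t ht
    have d1 : HasDerivAt q₁ (p₁ t) t := by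
      refine (hq₁ t ht).congr_deriv (HasDerivAt.deriv ?_)
      rw [hH]
      refine (((((hasDerivAt_pow 2 (p₁ t)).add_const (p₂ t ^ 2)).const_mul (1 / 2)).add_const
        _).congr_deriv ?_)
      norm_num
      ring
    have d2 : HasDerivAt q₂ (p₂ t) t := by
      refine (hq₂ t ht).congr_deriv (HasDerivAt.deriv ?_)
      rw [hH]
      refine (((((hasDerivAt_pow 2 (p₂ t)).const_add (p₁ t ^ 2)).const_mul (1 / 2)).add_const
        _).congr_deriv ?_)
      norm_num
      ring
    have d3 := hp₁ t ht
    have d4 := hp₂ t ht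
    simp only [hH] at d3 d4
    rw [(hasDerivAt_ttw_hamiltonian_fst k _ hR0 hCt).deriv] at d3
    rw [(hasDerivAt_ttw_hamiltonian_snd k _ hR0 hCt).deriv] at d4
    have hz : HasDerivAt (fun s => ((q₁ s : ℂ) + q₂ s * Complex.I) ^ (k + 1))
        ((k + 1 : ℕ) * ((q₁ t : ℂ) + q₂ t * Complex.I) ^ k * (p₁ t + p₂ t * Complex.I)) t := by
      simpa using (d1.ofReal_comp.fun_add (d2.ofReal_comp.mul_const Complex.I)).fun_pow (k + 1)
    have hzre := Complex.reCLM.hasFDerivAt.comp_hasDerivAt t hz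
    have hzim := Complex.imCLM.hasFDerivAt.comp_hasDerivAt t hz
    have hCe : C t = q₁ t * (((q₁ t : ℂ) + q₂ t * Complex.I) ^ k).re
        - q₂ t * (((q₁ t : ℂ) + q₂ t * Complex.I) ^ k).im := by
      simp only [hCdef, pow_succ]
      simp
      ring
    have hSe : S t = q₁ t * (((q₁ t : ℂ) + q₂ t * Complex.I) ^ k).im
        + q₂ t * (((q₁ t : ℂ) + q₂ t * Complex.I) ^ k).re := by
      simp only [hSdef, pow_succ]
      simp
      ring
    change HasDerivAt C _ t at hzre
    change HasDerivAt S _ t at hzim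
    simp only [Complex.reCLM_apply, Complex.imCLM_apply, mul_assoc, ← Complex.ofReal_natCast,
      Complex.re_ofReal_mul, Complex.im_ofReal_mul] at hzre hzim
    simp only [Complex.mul_im, Complex.mul_re, Complex.add_im, Complex.add_re,
      Complex.ofReal_re, Complex.ofReal_im, Complex.I_re, Complex.I_im] at hzre hzim
    change HasDerivAt p₁ (-(2 * k * q₁ t * R t ^ k / (R t * C t ^ 2)
      - 2 * (k + 1) * R t ^ k * _ / C t ^ 3)) t at d3
    change HasDerivAt p₂ (-(2 * k * q₂ t * R t ^ k / (R t * C t ^ 2)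
      + 2 * (k + 1) * R t ^ k * _ / C t ^ 3)) t at d4
    have hRe : R t = q₁ t ^ 2 + q₂ t ^ 2 := rfl
    generalize (((q₁ t : ℂ) + q₂ t * Complex.I) ^ k).re = a at *
    generalize (((q₁ t : ℂ) + q₂ t * Complex.I) ^ k).im = b at *
    refine hasDerivAt_closed_form_zero k (P := p₁ t ^ 2 + p₂ t ^ 2) hR0 hCt ?_ ?_ ?_ ?_ ?_ ?_
    · simp only [hRdef, hρdef, hLdef]; ring
    · refine ((d1.fun_pow 2).fun_add (d2.fun_pow 2)).congr_deriv ?_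
      simp only [hρdef]; norm_num; ring
    · refine ((d1.fun_mul d3).fun_add (d2.fun_mul d4)).congr_deriv ?_
      field_simp
      rw [hCe, hRe]
      ring
    · refine ((d1.fun_mul d4).fun_sub (d2.fun_mul d3)).congr_deriv ?_
      rw [hSe]
      field_simp
      ring
    · refine hzre.congr_deriv ?_
      rw [hCe, hSe, eq_div_iff hR0.ne', hRe]
      simp only [hρdef, hLdef]; push_cast; ring
    · refine hzim.congr_deriv ?_
      rw [hCe, hSe, eq_div_iff hR0.ne', hRe]
      simp only [hρdef, hLdef]; push_cast; ring
  have hform : ∀ t ∈ Set.Ioo α β, ttwIntegral (k + 1) (q₁ t) (q₂ t) (p₁ t) (p₂ t) =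
      ((((ρ t : ℝ) : ℂ) - (√(L t ^ 2 + 2 * (R t ^ (k + 1) / C t ^ 2)) : ℝ) * Complex.I) ^ (k + 1) *
          (((√(L t ^ 2 + 2 * (R t ^ (k + 1) / C t ^ 2)) * S t : ℝ) : ℂ)
            + ((L t * C t : ℝ) : ℂ) * Complex.I)).re
        / (√(L t ^ 2 + 2 * (R t ^ (k + 1) / C t ^ 2)) * R t ^ (k + 1)) := by
    intro t ht
    have hR0 : 0 < R t := (hreg t ht).1
    have hCt := hC0 t ht
    have hpos : 0 < L t ^ 2 + 2 * (R t ^ (k + 1) / C t ^ 2) := by positivity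
    exact ttwIntegral_eq_re (k + 1) hR0 hCt (Real.sqrt_pos.2 hpos) (Real.sq_sqrt hpos.le)
  intro t ht s hs
  rw [hform t ht, hform s hs]
  exact isOpen_Ioo.is_const_of_deriv_eq_zero isPreconnected_Ioo
    (fun u hu => (hderiv u hu).differentiableAt.differentiableWithinAt)
    (fun u hu => (hderiv u hu).deriv) ht hs
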